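/- Let H be the integral Heisenberg group, i.e. the group of 3×3 upper unitriangular matrices with integer entries, with finite generating set S. Then Farb_{H,S}(n) ≈ (log(n))^3. -/

import Mathlib

open Subgroup

/-- Word length of `g` with respect to a generating set `S`: the least length of a word in
`S ∪ S⁻¹` representing `g`. -/
noncomputable def wordLength {G : Type*} [Group G] (S : Set G) (g : G) : ℕ :=
  sInf {n : ℕ | ∃ w : List G, w.length = n ∧ (∀ x ∈ w, x ∈ S ∨ x⁻¹ ∈ S) ∧ w.prod = g}

/-- The depth `D_G(g)`: the minimal order of a finite group admitting a surjective
homomorphism from `G` that does not kill `g`. -/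
noncomputable def depthFn {G : Type*} [Group G] (g : G) : ℕ :=
  sInf {n : ℕ | ∃ (Q : Type) (_ : Group Q) (_ : Fintype Q) (φ : G →* Q),
    Function.Surjective φ ∧ φ g ≠ 1 ∧ Fintype.card Q = n}

/-- The residual finiteness function `Farb_{G,S}(n)`: the maximum of `D_G(g)` over nontrivial
`g` of word length at most `n`. -/
noncomputable def Farb {G : Type*} [Group G] (S : Set G) (n : ℕ) : ℕ :=
  sSup {d : ℕ | ∃ g : G, g ≠ 1 ∧ wordLength S g ≤ n ∧ depthFn g = d}

/-- `f ≾ g` : there is a constant `C > 0` with `f n ≤ C * g (C * n)` for all `n`. -/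
def Precsim (f g : ℕ → ℕ) : Prop := ∃ C : ℕ, 0 < C ∧ ∀ n, f n ≤ C * g (C * n)

/-- `f ≈ g` : `f ≾ g` and `g ≾ f`. -/
def AsympEquiv (f g : ℕ → ℕ) : Prop := Precsim f g ∧ Precsim g f

/-- The integral Heisenberg group: the group of `3 × 3` upper unitriangular integer matrices
`[[1, a, c], [0, 1, b], [0, 0, 1]]`, recorded by their entries `a`, `b`, `c`.  Matrix
multiplication corresponds to `(a,b,c) * (a',b',c') = (a+a', b+b', c+c'+a*b')`. -/
@[ext] structure Heisenberg : Type where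
  a : ℤ
  b : ℤ
  c : ℤ

namespace Heisenberg

instance : Mul Heisenberg := ⟨fun g h => ⟨g.a + h.a, g.b + h.b, g.c + h.c + g.a * h.b⟩⟩
instance : One Heisenberg := ⟨⟨0, 0, 0⟩⟩
instance : Inv Heisenberg := ⟨fun g => ⟨-g.a, -g.b, -g.c + g.a * g.b⟩⟩

@[simp] lemma mul_a (g h : Heisenberg) : (g * h).a = g.a + h.a := rfl
@[simp] lemma mul_b (g h : Heisenberg) : (g * h).b = g.b + h.b := rfl
@[simp] lemma mul_c (g h : Heisenberg) : (g * h).c = g.c + h.c + g.a * h.b := rfl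
@[simp] lemma one_a : (1 : Heisenberg).a = 0 := rfl
@[simp] lemma one_b : (1 : Heisenberg).b = 0 := rfl
@[simp] lemma one_c : (1 : Heisenberg).c = 0 := rfl
@[simp] lemma inv_a (g : Heisenberg) : g⁻¹.a = -g.a := rfl
@[simp] lemma inv_b (g : Heisenberg) : g⁻¹.b = -g.b := rfl
@[simp] lemma inv_c (g : Heisenberg) : g⁻¹.c = -g.c + g.a * g.b := rfl

instance : Group Heisenberg where
  mul_assoc g h k := by ext <;> simp <;> ring
  one_mul g := by ext <;> simp
  mul_one g := by ext <;> simp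
  inv_mul_cancel g := by ext <;> simp

end Heisenberg

section LcmUpto

open Chebyshev Nat

lemma two_pow_le_lcmUpto (k : ℕ) : 2 ^ k ≤ lcmUpto (3 * k) := by
  have hlin : 3 * k + 1 ≤ 4 ^ k := by
    induction k with
    | zero => simp
    | succ k ih => rw [pow_succ]; omega
  have h := two_pow_le_mul_lcmUpto (3 * k)
  have hsplit : 2 ^ (3 * k) = 4 ^ k * 2 ^ k := by
    rw [pow_mul, ← mul_pow]; norm_num
  rw [hsplit] at h
  exact Nat.le_of_mul_le_mul_left (h.trans (Nat.mul_le_mul_right _ hlin)) (by positivity)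

lemma lcmUpto_le_two_pow (k : ℕ) : lcmUpto k ≤ 2 ^ (8 * k) := by
  have hpos : (0 : ℝ) < lcmUpto k := by exact_mod_cast lcmUpto_pos k
  have h := psi_le_const_mul_self (x := (k : ℝ)) (by positivity)
  rw [psi_eq_log_lcmUpto] at h
  have hlog4 : Real.log 4 = 2 * Real.log 2 := by
    rw [show (4 : ℝ) = 2 ^ 2 by norm_num, Real.log_pow]; norm_num
  have hlog : Real.log (lcmUpto k) ≤ Real.log (2 ^ (8 * k)) := by
    rw [Real.log_pow]
    push_cast
    nlinarith [Real.log_two_gt_d9, (Nat.cast_nonneg k : (0 : ℝ) ≤ k)]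
  exact_mod_cast (Real.log_le_log_iff hpos (by positivity)).1 hlog

lemma dvd_lcmUpto {m k : ℕ} (hm : 0 < m) (hmk : m ≤ k) : m ∣ lcmUpto k :=
  Finset.dvd_lcm (f := id) (Finset.mem_Icc.2 ⟨hm, hmk⟩)

/-- A nonzero integer of absolute value below `2 ^ k` has a non-divisor of size at most `3 * k`. -/
lemma exists_not_dvd_of_lt_two_pow {x : ℤ} (hx : x ≠ 0) {k : ℕ} (hk : x.natAbs < 2 ^ k) :
    ∃ m : ℕ, 0 < m ∧ m ≤ 3 * k ∧ ¬ (m : ℤ) ∣ x := by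
  by_contra! h
  have hdvd : lcmUpto (3 * k) ∣ x.natAbs := Finset.lcm_dvd fun m hm => by
    rw [Finset.mem_Icc] at hm
    exact Int.natCast_dvd.1 (h m hm.1 hm.2)
  have := Nat.le_of_dvd (Int.natAbs_pos.2 hx) hdvd
  have := two_pow_le_lcmUpto k
  omega

end LcmUpto

section WordLength

variable {G : Type*} [Group G] {S : Set G}

lemma wordLength_spec (hgen : Subgroup.closure S = ⊤) (g : G) :
    ∃ w : List G, w.length = wordLength S g ∧ (∀ x ∈ w, x ∈ S ∨ x⁻¹ ∈ S) ∧ w.prod = g := by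
  have hg : g ∈ (Subgroup.closure S).toSubmonoid := hgen ▸ Subgroup.mem_top g
  rw [Subgroup.closure_toSubmonoid] at hg
  obtain ⟨w, hw, hprod⟩ := Submonoid.exists_list_of_mem_closure hg
  exact Nat.sInf_mem (s := {n : ℕ | ∃ w : List G, w.length = n ∧
    (∀ x ∈ w, x ∈ S ∨ x⁻¹ ∈ S) ∧ w.prod = g}) ⟨_, w, rfl, hw, hprod⟩

lemma wordLength_pow_le (hgen : Subgroup.closure S = ⊤) (g : G) (n : ℕ) :
    wordLength S (g ^ n) ≤ wordLength S g * n := by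
  obtain ⟨w, hlen, hw, hprod⟩ := wordLength_spec hgen g
  refine Nat.sInf_le ⟨(List.replicate n w).flatten, ?_, ?_, ?_⟩
  · simp [hlen, mul_comm]
  · intro x hx
    obtain ⟨l, hl, hxl⟩ := List.mem_flatten.1 hx
    exact hw x (List.eq_of_mem_replicate hl ▸ hxl)
  · simp [List.prod_flatten, hprod]

end WordLength

section Depth

variable {G : Type} [Group G]

lemma depthFn_le_index {g : G} (N : Subgroup G) [N.Normal] [Finite (G ⧸ N)] (hg : g ∉ N) :
    depthFn g ≤ N.index := by
  have := Fintype.ofFinite (G ⧸ N)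
  refine Nat.sInf_le ⟨G ⧸ N, inferInstance, inferInstance, QuotientGroup.mk' N,
    QuotientGroup.mk'_surjective N, ?_, ?_⟩
  · rwa [Ne, QuotientGroup.mk'_apply, QuotientGroup.eq_one_iff]
  · rw [Subgroup.index, Nat.card_eq_fintype_card]

lemma le_depthFn {g : G} {d : ℕ} (N : Subgroup G) [N.Normal] [Finite (G ⧸ N)] (hg : g ∉ N)
    (h : ∀ (Q : Type) [Group Q] [Fintype Q] (φ : G →* Q), φ g ≠ 1 → d ≤ Fintype.card Q) :
    d ≤ depthFn g := by
  have := Fintype.ofFinite (G ⧸ N)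
  refine le_csInf ⟨_, G ⧸ N, inferInstance, inferInstance, QuotientGroup.mk' N,
    QuotientGroup.mk'_surjective N, ?_, rfl⟩ ?_
  · rwa [Ne, QuotientGroup.mk'_apply, QuotientGroup.eq_one_iff]
  · rintro _ ⟨Q, _, _, φ, -, hφ, rfl⟩
    exact h Q φ hφ

end Depth

namespace Heisenberg

/-- The principal congruence subgroup of level `m`. -/
def congruenceSubgroup (m : ℕ) : Subgroup Heisenberg where
  carrier := {g | (m : ℤ) ∣ g.a ∧ (m : ℤ) ∣ g.b ∧ (m : ℤ) ∣ g.c}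
  one_mem' := by simp
  mul_mem' := by
    rintro g h ⟨ga, gb, gc⟩ ⟨ha, hb, hc⟩
    exact ⟨dvd_add ga ha, dvd_add gb hb, dvd_add (dvd_add gc hc) (hb.mul_left _)⟩
  inv_mem' := by
    rintro g ⟨ga, gb, gc⟩
    exact ⟨ga.neg_right, gb.neg_right, dvd_add gc.neg_right (gb.mul_left _)⟩

instance (m : ℕ) : (congruenceSubgroup m).Normal where
  conj_mem := by
    rintro n ⟨ha, hb, hc⟩ g
    refine ⟨by simpa using ha, by simpa using hb, ?_⟩
    have : (g * n * g⁻¹).c = n.c + g.a * n.b - n.a * g.b := by simp; ring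
    rw [this]
    exact dvd_sub (dvd_add hc (hb.mul_left _)) (ha.mul_right _)

/-- Reduction of the coordinates modulo `m`. -/
def residues (m : ℕ) (g : Heisenberg) : ZMod m × ZMod m × ZMod m := (g.a, g.b, g.c)

lemma inv_mul_mem_congruenceSubgroup_of_residues_eq {m : ℕ} {g h : Heisenberg}
    (hgh : residues m g = residues m h) : g⁻¹ * h ∈ congruenceSubgroup m := by
  simp only [residues, Prod.mk.injEq, ZMod.intCast_eq_intCast_iff_dvd_sub] at hgh
  obtain ⟨ha, hb, hc⟩ := hgh
  refine ⟨?_, ?_, ?_⟩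
  · simpa [neg_add_eq_sub] using ha
  · simpa [neg_add_eq_sub] using hb
  · have : (g⁻¹ * h).c = h.c - g.c - g.a * (h.b - g.b) := by simp; ring
    rw [this]
    exact dvd_sub hc (hb.mul_left _)

lemma residues_out_injective (m : ℕ) :
    Function.Injective fun q : Heisenberg ⧸ congruenceSubgroup m => residues m q.out := by
  intro q r hqr
  rw [← q.out_eq', ← r.out_eq']
  exact QuotientGroup.eq.2 (inv_mul_mem_congruenceSubgroup_of_residues_eq hqr)

instance (m : ℕ) [NeZero m] : Finite (Heisenberg ⧸ congruenceSubgroup m) :=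
  Finite.of_injective _ (residues_out_injective m)

lemma index_congruenceSubgroup_le (m : ℕ) [NeZero m] : (congruenceSubgroup m).index ≤ m ^ 3 := by
  calc (congruenceSubgroup m).index ≤ Nat.card (ZMod m × ZMod m × ZMod m) :=
        Nat.card_le_card_of_injective _ (residues_out_injective m)
    _ = m ^ 3 := by simp only [Nat.card_prod, Nat.card_zmod]; ring

lemma exists_notMem_congruenceSubgroup {g : Heisenberg} (hg : g ≠ 1) {k : ℕ}
    (ha : g.a.natAbs < 2 ^ k) (hb : g.b.natAbs < 2 ^ k) (hc : g.c.natAbs < 2 ^ k) :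
    ∃ m : ℕ, 0 < m ∧ m ≤ 3 * k ∧ g ∉ congruenceSubgroup m := by
  by_cases h1 : g.a ≠ 0
  · obtain ⟨m, hm, hmk, hd⟩ := exists_not_dvd_of_lt_two_pow h1 ha
    exact ⟨m, hm, hmk, fun h => hd h.1⟩
  by_cases h2 : g.b ≠ 0
  · obtain ⟨m, hm, hmk, hd⟩ := exists_not_dvd_of_lt_two_pow h2 hb
    exact ⟨m, hm, hmk, fun h => hd h.2.1⟩
  by_cases h3 : g.c ≠ 0
  · obtain ⟨m, hm, hmk, hd⟩ := exists_not_dvd_of_lt_two_pow h3 hc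
    exact ⟨m, hm, hmk, fun h => hd h.2.2⟩
  · push Not at h1 h2 h3
    exact absurd (Heisenberg.ext h1 h2 h3) hg

lemma depthFn_le {g : Heisenberg} (hg : g ≠ 1) {k : ℕ}
    (ha : g.a.natAbs < 2 ^ k) (hb : g.b.natAbs < 2 ^ k) (hc : g.c.natAbs < 2 ^ k) :
    depthFn g ≤ (3 * k) ^ 3 := by
  obtain ⟨m, hm, hmk, hgm⟩ := exists_notMem_congruenceSubgroup hg ha hb hc
  have : NeZero m := ⟨hm.ne'⟩
  exact (depthFn_le_index _ hgm).trans
    ((index_congruenceSubgroup_le m).trans (Nat.pow_le_pow_left hmk 3))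

/-- Products of `n` elements with coordinates bounded by `M` have linearly bounded abelian
coordinates and a quadratically bounded central coordinate. -/
lemma abs_prod_le {M : ℤ} (hM : 1 ≤ M) (w : List Heisenberg)
    (hw : ∀ x ∈ w, |x.a| ≤ M ∧ |x.b| ≤ M ∧ |x.c| ≤ M) :
    |w.prod.a| ≤ M * w.length ∧ |w.prod.b| ≤ M * w.length ∧ |w.prod.c| ≤ (M * w.length) ^ 2 := by
  induction w with
  | nil => simp
  | cons s w ih =>
    obtain ⟨iha, ihb, ihc⟩ := ih fun x hx => hw x (List.mem_cons_of_mem _ hx)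
    obtain ⟨ha, hb, hc⟩ := hw s List.mem_cons_self
    have hlen : (0 : ℤ) ≤ w.length := by positivity
    simp only [List.prod_cons, mul_a, mul_b, mul_c, List.length_cons, Nat.cast_add, Nat.cast_one]
    refine ⟨?_, ?_, ?_⟩
    · linarith [abs_add_le s.a w.prod.a]
    · linarith [abs_add_le s.b w.prod.b]
    · have hab : |s.a * w.prod.b| ≤ M * (M * w.length) := by
        rw [abs_mul]
        exact mul_le_mul ha ihb (abs_nonneg _) (by linarith)
      have h1 := abs_add_le (s.c + w.prod.c) (s.a * w.prod.b)
      have h2 := abs_add_le s.c w.prod.c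
      have h3 : 0 ≤ M * M * (w.length : ℤ) := by positivity
      nlinarith

lemma exists_coordinate_bound {S : Set Heisenberg} (hS : S.Finite) :
    ∃ M : ℕ, 2 ≤ M ∧ ∀ x : Heisenberg, x ∈ S ∨ x⁻¹ ∈ S →
      |x.a| ≤ M ∧ |x.b| ≤ M ∧ |x.c| ≤ M := by
  have hfin : (S ∪ S⁻¹).Finite := hS.union hS.inv
  obtain ⟨M, hM⟩ := (hfin.image fun x => x.a.natAbs + x.b.natAbs + x.c.natAbs).bddAbove
  refine ⟨M + 2, by omega, fun x hx => ?_⟩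
  have : x.a.natAbs + x.b.natAbs + x.c.natAbs ≤ M := hM ⟨x, by simpa using hx, rfl⟩
  simp only [Int.abs_eq_natAbs]
  omega

/-- The generator of the centre. -/
def central : Heisenberg := ⟨0, 0, 1⟩

lemma central_pow (n : ℕ) : central ^ n = ⟨0, 0, n⟩ := by
  induction n with
  | zero => rfl
  | succ n ih => rw [pow_succ, ih]; ext <;> simp [central]

lemma mk_eq_mul_central_pow (i j l : ℕ) :
    (⟨i, j, l⟩ : Heisenberg) = ⟨i, j, 0⟩ * central ^ l := by
  rw [central_pow]; ext <;> simp

/-- A finite image of the Heisenberg group in which the centre has image of order `d` has order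
at least `d ^ 3`. -/
lemma orderOf_central_pow_three_le {Q : Type*} [Group Q] [Fintype Q] (φ : Heisenberg →* Q) :
    orderOf (φ central) ^ 3 ≤ Fintype.card Q := by
  set d := orderOf (φ central) with hd
  let f : Fin d × Fin d × Fin d → Q := fun t => φ ⟨(t.1 : ℕ), (t.2.1 : ℕ), (t.2.2 : ℕ)⟩
  have key {m n : ℕ} (hm : m < d) (hn : n < d) (h : φ central ^ m = φ central ^ n) : m = n :=
    pow_injOn_Iio_orderOf hm hn h
  have hf : Function.Injective f := by
    rintro ⟨i, j, l⟩ ⟨i', j', l'⟩ h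
    have hcomm (g : Heisenberg) : φ (⟨i, j, l⟩ * g * (⟨i, j, l⟩ : Heisenberg)⁻¹ * g⁻¹) =
        φ (⟨i', j', l'⟩ * g * (⟨i', j', l'⟩ : Heisenberg)⁻¹ * g⁻¹) := by
      simp only [map_mul, map_inv]
      rw [show φ ⟨i, j, l⟩ = φ ⟨i', j', l'⟩ from h]
    have hi : (i : ℕ) = i' := by
      refine key i.2 i'.2 ?_
      have := hcomm ⟨0, 1, 0⟩
      rw [← map_pow, ← map_pow, central_pow, central_pow]
      convert this using 2 <;> ext <;> simp <;> ring
    have hj : (j : ℕ) = j' := by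
      refine key j.2 j'.2 ?_
      have := hcomm ⟨-1, 0, 0⟩
      rw [← map_pow, ← map_pow, central_pow, central_pow]
      convert this using 2 <;> ext <;> simp <;> ring
    have hl : (l : ℕ) = l' := by
      refine key l.2 l'.2 ?_
      have h' : φ ⟨(i : ℕ), (j : ℕ), (l : ℕ)⟩ = φ ⟨(i' : ℕ), (j' : ℕ), (l' : ℕ)⟩ := h
      rw [mk_eq_mul_central_pow, mk_eq_mul_central_pow i', hi, hj, map_mul, map_mul] at h'
      simpa using h'
    simp [Fin.ext_iff, hi, hj, hl]
  have hcard := Fintype.card_le_of_injective f hf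
  simp only [Fintype.card_prod, Fintype.card_fin] at hcard
  calc d ^ 3 = d * (d * d) := by ring
    _ ≤ _ := hcard

lemma central_pow_ne_one {n : ℕ} (hn : n ≠ 0) : central ^ n ≠ 1 := by
  intro h
  rw [central_pow] at h
  exact hn (by simpa using congrArg Heisenberg.c h)

lemma pow_three_le_depthFn_central_pow_lcmUpto (k : ℕ) :
    (k + 1) ^ 3 ≤ depthFn (central ^ Nat.lcmUpto k) := by
  set L := Nat.lcmUpto k with hL
  have hL0 : 0 < L := Nat.lcmUpto_pos k
  refine le_depthFn (congruenceSubgroup (L + 1)) ?_ fun Q _ _ φ hφ => ?_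
  · rintro ⟨-, -, h⟩
    rw [central_pow] at h
    have := Nat.le_of_dvd hL0 (Int.natCast_dvd_natCast.1 h)
    omega
  · refine le_trans (Nat.pow_le_pow_left ?_ 3) (orderOf_central_pow_three_le φ)
    by_contra! hlt
    refine hφ ?_
    rw [map_pow]
    exact orderOf_dvd_iff_pow_eq_one.1 (dvd_lcmUpto (orderOf_pos _) (by omega))

lemma exists_depthFn_le {S : Set Heisenberg} (hS : S.Finite) (hgen : Subgroup.closure S = ⊤) :
    ∃ M : ℕ, 0 < M ∧ ∀ (n : ℕ) (g : Heisenberg), g ≠ 1 → wordLength S g ≤ n →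
      depthFn g ≤ 1728 * Nat.log 2 (M * n) ^ 3 := by
  obtain ⟨M, hM2, hM⟩ := exists_coordinate_bound hS
  refine ⟨M, by omega, fun n g hg hgn => ?_⟩
  obtain ⟨w, hlen, hw, rfl⟩ := wordLength_spec hgen g
  rw [← hlen] at hgn
  have hn : 1 ≤ n := by
    refine (List.length_pos_of_ne_nil ?_).trans_le hgn
    rintro rfl
    exact hg rfl
  obtain ⟨ha, hb, hc⟩ := abs_prod_le (by exact_mod_cast (by omega : 1 ≤ M)) w
    fun x hx => hM x (hw x hx)
  set ℓ := Nat.log 2 (M * n) with hℓ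
  have hℓ1 : 1 ≤ ℓ := Nat.log_pos (by norm_num) (by nlinarith)
  have hlt : (M * n) ^ 2 < 2 ^ (4 * ℓ) := by
    calc (M * n) ^ 2 < (2 ^ (ℓ + 1)) ^ 2 :=
          Nat.pow_lt_pow_left (Nat.lt_pow_succ_log_self (by norm_num) _) (by norm_num)
      _ = 2 ^ (2 * (ℓ + 1)) := by rw [← pow_mul, mul_comm]
      _ ≤ 2 ^ (4 * ℓ) := Nat.pow_le_pow_right (by norm_num) (by omega)
  have hlen' : (M : ℤ) * w.length ≤ M * n := by gcongr
  have hMn : (1 : ℤ) ≤ M * n := by exact_mod_cast (by nlinarith : 1 ≤ M * n)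
  have hlt' : ((M : ℤ) * n) ^ 2 < 2 ^ (4 * ℓ) := by exact_mod_cast hlt
  have hlin : (M : ℤ) * w.length < 2 ^ (4 * ℓ) := by nlinarith
  have hsq : ((M : ℤ) * w.length) ^ 2 < 2 ^ (4 * ℓ) :=
    (pow_le_pow_left₀ (by positivity) hlen' 2).trans_lt hlt'
  have toNat {x : ℤ} (hx : |x| < 2 ^ (4 * ℓ)) : x.natAbs < 2 ^ (4 * ℓ) := by
    rw [Int.abs_eq_natAbs] at hx
    exact_mod_cast hx
  calc depthFn w.prod ≤ (3 * (4 * ℓ)) ^ 3 :=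
        depthFn_le hg (toNat (ha.trans_lt hlin)) (toNat (hb.trans_lt hlin)) (toNat (hc.trans_lt hsq))
    _ = 1728 * ℓ ^ 3 := by ring

end Heisenberg

/-- For the integral Heisenberg group `H` (the `3 × 3` upper unitriangular integer matrices)
with any finite generating set `S`, `Farb_{H,S}(n) ≈ (log n)^3`. -/
theorem stmt7 (S : Set Heisenberg) (hS : S.Finite) (hgen : Subgroup.closure S = ⊤) :
    AsympEquiv (Farb S) (fun n => (Nat.log 2 n) ^ 3) := by
  obtain ⟨M, hM0, hM⟩ := Heisenberg.exists_depthFn_le hS hgen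
  constructor
  · refine ⟨1728 * M, by omega, fun n => csSup_le' ?_⟩
    rintro _ ⟨g, hg, hgn, rfl⟩
    refine (hM n g hg hgn).trans (Nat.mul_le_mul (by omega) (Nat.pow_le_pow_left ?_ 3))
    exact Nat.log_mono_right (Nat.mul_le_mul_right n (by omega))
  · set K := wordLength S Heisenberg.central with hK
    refine ⟨512 * (K + 1), by omega, fun n => ?_⟩
    rcases Nat.eq_zero_or_pos n with rfl | hn
    · simp
    set k := Nat.log 2 n / 8 with hk
    have hL : Nat.lcmUpto k ≤ n :=
      (lcmUpto_le_two_pow k).trans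
        ((Nat.pow_le_pow_right (by norm_num) (by omega)).trans (Nat.pow_log_le_self 2 hn.ne'))
    have hbdd : BddAbove {d : ℕ | ∃ g : Heisenberg, g ≠ 1 ∧
        wordLength S g ≤ 512 * (K + 1) * n ∧ depthFn g = d} := by
      refine ⟨1728 * Nat.log 2 (M * (512 * (K + 1) * n)) ^ 3, ?_⟩
      rintro _ ⟨g, hg, hgn, rfl⟩
      exact hM _ g hg hgn
    have hFarb : (k + 1) ^ 3 ≤ Farb S (512 * (K + 1) * n) := by
      refine (Heisenberg.pow_three_le_depthFn_central_pow_lcmUpto k).trans (le_csSup hbdd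
        ⟨_, Heisenberg.central_pow_ne_one (Nat.lcmUpto_ne_zero k), ?_, rfl⟩)
      exact (wordLength_pow_le hgen _ _).trans (Nat.mul_le_mul (by omega) hL)
    calc Nat.log 2 n ^ 3 ≤ (8 * (k + 1)) ^ 3 := Nat.pow_le_pow_left (by omega) 3
      _ = 512 * (k + 1) ^ 3 := by ring
      _ ≤ 512 * (K + 1) * Farb S (512 * (K + 1) * n) := Nat.mul_le_mul (by omega) hFarb
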